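/- The BMW-algebra-valued Yang-Baxter operator Y_{i,i+1}(z) satisfies the multiplicative Yang-Baxter equation Y_{12}(z) Y_{23}(zw) Y_{12}(w) = Y_{23}(w) Y_{12}(zw) Y_{23}(z). -/

import Mathlib

/-- The remaining word reductions in the BMW algebra `B₃`, for one of the two orderings of the
generators: `t` and `e` belong to one strand pair, `u` and `f` to the other. -/
theorem bmw_word_reductions {F : Type*} [Field F] {R : Type*} [Ring R] [Algebra F R]
    {ε : F} {t u tinv e f : R}
    (ht : t * tinv = 1) (ht' : tinv * t = 1)
    (hefe : e * f * e = e)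
    (hskein : t - tinv = ε • (1 - e))
    (htw : t * u * e = f * e) (htw' : e * u * t = e * f) :
    t * f * e = u * e + ε • (f * e) - ε • e ∧ e * f * t = e * u + ε • (e * f) - ε • e := by
  have hsk : t = tinv + ε • (1 - e) := by rw [← hskein]; abel
  have hl : tinv * (f * e) = u * e := by
    rw [← htw, mul_assoc, ← mul_assoc, ht', one_mul]
  have hr : e * f * tinv = e * u := by
    rw [← htw', mul_assoc, ht, mul_one]
  constructor
  · rw [mul_assoc, hsk, add_mul, hl, smul_mul_assoc, sub_mul, one_mul, ← mul_assoc, hefe, smul_sub]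
    abel
  · rw [hsk, mul_add, hr, mul_smul_comm, mul_sub, mul_one, hefe, smul_sub]
    abel

/-- The BMW-algebra-valued Baxterized operator
`Y_{i,i+1}(z) = D(z)⁻¹[(z-1)p⁻¹a⁻¹ t_i - ε(1 - p⁻¹a⁻¹) + (z⁻¹-1)t_i⁻¹]`,
`D(z) = (z-q²)(z-p²)p⁻¹z⁻¹`, satisfies the multiplicative Yang–Baxter equation
`Y₁₂(z) Y₂₃(zw) Y₁₂(w) = Y₂₃(w) Y₁₂(zw) Y₂₃(z)` in `B₃`. -/
theorem bmw_yang_baxter {F : Type*} [Field F]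
    {R : Type*} [Ring R] [Algebra F R]
    (p q z w : F) (hp : p ≠ 0) (hq : q ≠ 0) (hz : z ≠ 0) (hw : w ≠ 0)
    (a ε τ : F)
    (ha : a = p⁻¹ * q⁻¹ ^ 2) (hε : ε = p - p⁻¹)
    (hτ : τ = (p * q - p⁻¹ * q⁻¹) * (q + q⁻¹) / (p - p⁻¹))
    (D : F → F) (hD : ∀ x : F, D x = (x - q ^ 2) * (x - p ^ 2) * p⁻¹ * x⁻¹)
    (hDz : D z ≠ 0) (hDw : D w ≠ 0) (hDzw : D (z * w) ≠ 0)
    (t₁ t₂ t₁inv t₂inv e₁ e₂ : R)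
    (ht₁ : t₁ * t₁inv = 1) (ht₁' : t₁inv * t₁ = 1)
    (ht₂ : t₂ * t₂inv = 1) (ht₂' : t₂inv * t₂ = 1)
    (hbraid : t₁ * t₂ * t₁ = t₂ * t₁ * t₂)
    (heee : e₁ * e₂ * e₁ = e₁) (heee' : e₂ * e₁ * e₂ = e₂)
    (hskein₁ : t₁ - t₁inv = ε • (1 - e₁)) (hskein₂ : t₂ - t₂inv = ε • (1 - e₂))
    (het₁ : e₁ * t₁ = a • e₁) (hte₁ : t₁ * e₁ = a • e₁)
    (het₂ : e₂ * t₂ = a • e₂) (hte₂ : t₂ * e₂ = a • e₂)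
    (hee₁ : e₁ * e₁ = τ • e₁) (hee₂ : e₂ * e₂ = τ • e₂)
    (hete₁ : e₁ * t₂ * e₁ = a⁻¹ • e₁) (hete₂ : e₂ * t₁ * e₂ = a⁻¹ • e₂)
    (htw₁ : t₂ * t₁ * e₂ = e₁ * t₂ * t₁) (htw₂ : e₁ * t₂ * t₁ = e₁ * e₂)
    (htw₃ : t₁ * t₂ * e₁ = e₂ * t₁ * t₂) (htw₄ : e₂ * t₁ * t₂ = e₂ * e₁)
    (Y₁ Y₂ : F → R)
    (hY₁ : ∀ x : F, x ≠ 0 → Y₁ x = (D x)⁻¹ •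
      (((x - 1) * p⁻¹ * a⁻¹) • t₁ - (ε * (1 - p⁻¹ * a⁻¹)) • (1 : R)
        + (x⁻¹ - 1) • t₁inv))
    (hY₂ : ∀ x : F, x ≠ 0 → Y₂ x = (D x)⁻¹ •
      (((x - 1) * p⁻¹ * a⁻¹) • t₂ - (ε * (1 - p⁻¹ * a⁻¹)) • (1 : R)
        + (x⁻¹ - 1) • t₂inv)) :
    Y₁ z * Y₂ (z * w) * Y₁ w = Y₂ w * Y₁ (z * w) * Y₂ z := by
  obtain ⟨ht₁ee, heet₁⟩ := bmw_word_reductions ht₁ ht₁' heee hskein₁ (htw₃.trans htw₄) htw₂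
  obtain ⟨ht₂ee, heet₂⟩ :=
    bmw_word_reductions ht₂ ht₂' heee' hskein₂ (htw₁.trans htw₂) htw₄
  have hinv₁ : t₁inv = t₁ - ε • (1 - e₁) := by rw [← hskein₁]; abel
  have hinv₂ : t₂inv = t₂ - ε • (1 - e₂) := by rw [← hskein₂]; abel
  have htt₁ : t₁ * t₁ = ε • t₁ + 1 - (ε * a) • e₁ := by
    rw [hinv₁, mul_sub, mul_smul_comm, mul_sub, mul_one, hte₁] at ht₁
    rw [← ht₁]; module
  have htt₂ : t₂ * t₂ = ε • t₂ + 1 - (ε * a) • e₂ := by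
    rw [hinv₂, mul_sub, mul_smul_comm, mul_sub, mul_one, hte₂] at ht₂
    rw [← ht₂]; module
  have htet : t₁ * e₂ * t₁ = t₂inv * e₁ * t₂inv := by
    have hl : t₁ * e₂ = t₂inv * (e₁ * e₂) := by
      rw [← htw₂, ← htw₁, mul_assoc, ← mul_assoc, ht₂', one_mul]
    have hr : e₂ * t₁ = e₂ * e₁ * t₂inv := by
      rw [← htw₄, mul_assoc, ht₂, mul_one]
    rw [hl, mul_assoc, mul_assoc, hr, ← mul_assoc e₁, ← mul_assoc e₁, heee, mul_assoc]
  have htet' : t₁ * e₂ * t₁ = t₂ * e₁ * t₂ - ε • (t₂ * e₁) - ε • (e₁ * t₂) + (ε * ε) • e₁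
      + ε • (t₁ * e₂) + ε • (e₂ * t₁) - (ε * ε) • e₂ := by
    rw [htet, hinv₂]
    simp only [mul_sub, sub_mul, smul_mul_assoc, mul_smul_comm, mul_one, one_mul,
      ht₂ee, heet₂, heee']
    module
  rw [hY₁ z hz, hY₁ w hw, hY₁ _ (mul_ne_zero hz hw), hY₂ z hz, hY₂ w hw,
    hY₂ _ (mul_ne_zero hz hw)]
  simp only [smul_mul_smul_comm]
  rw [show (D w)⁻¹ * (D (z * w))⁻¹ * (D z)⁻¹ = (D z)⁻¹ * (D (z * w))⁻¹ * (D w)⁻¹ by ring]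
  congr 1
  have hcollect : ∀ (x : F) (t tinv e : R), tinv = t - ε • (1 - e) →
      ((x - 1) * p⁻¹ * a⁻¹) • t - (ε * (1 - p⁻¹ * a⁻¹)) • (1 : R) + (x⁻¹ - 1) • tinv
        = ((x - 1) * q ^ 2 + (x⁻¹ - 1)) • t + (ε * (q ^ 2 - x⁻¹)) • (1 : R)
          + (ε * (x⁻¹ - 1)) • e := by
    rintro x t _ e rfl
    have hpa : p⁻¹ * a⁻¹ = q ^ 2 := by rw [ha]; field_simp
    rw [mul_assoc, hpa]
    module
  simp only [hcollect _ _ _ _ hinv₁, hcollect _ _ _ _ hinv₂]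
  by_cases hp2 : p ^ 2 - 1 = 0
  · have hε0 : ε = 0 := by
      rw [hε]
      field_simp
      simpa using hp2
    simp only [hε0, zero_mul, zero_smul, add_zero, smul_mul_assoc, mul_smul_comm, hbraid]
    module
  have hτ' : τ = (p ^ 2 * q ^ 2 - 1) * (q ^ 2 + 1) / ((p ^ 2 - 1) * q ^ 2) := by
    have hε' : p - p⁻¹ = (p ^ 2 - 1) / p := by field_simp
    rw [hτ, hε']
    field_simp
  simp only [mul_add, add_mul, smul_mul_assoc, mul_smul_comm, mul_one, one_mul,
    htt₁, htt₂, hte₁, hte₂, het₁, het₂, hee₁, hee₂, ht₁ee, ht₂ee, heet₁, heet₂, heee, heee',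
    hete₁, hete₂, htw₁, htw₂, htw₃, htw₄, hbraid, htet']
  match_scalars
  all_goals
    try simp only [hτ', ha, hε]
    field_simp
    try ring
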